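/- arXiv:2512.24996 — 2 statements merged into one kernel-verified Lean document; each statement's English description precedes it below -/
import Mathlib

section
/- Let X be a locally compact Polish space. Then the relation 'closure(V) ∩ U ⊆ W' is Borel on O(X)³; that is, the set {(U, V, W) ∈ O(X) × O(X) × O(X) : closure(V) ∩ U ⊆ W} is a Borel subset of O(X) × O(X) × O(X). -/
open TopologicalSpace MeasureTheory

/-- The Fell topology on the space `F(X)` of closed subsets of `X`, generated by the
subbasic open sets `{F : F ∩ K = ∅}` for `K ⊆ X` compact and `{F : F ∩ U ≠ ∅}` for
`U ⊆ X` open. -/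
def fellTopology (X : Type*) [TopologicalSpace X] : TopologicalSpace (Closeds X) :=
  TopologicalSpace.generateFrom
    ({S | ∃ K : Set X, IsCompact K ∧ S = {F : Closeds X | (F : Set X) ∩ K = ∅}} ∪
      {S | ∃ U : Set X, IsOpen U ∧ S = {F : Closeds X | ((F : Set X) ∩ U).Nonempty}})

/-- The topology on the space `O(X)` of open subsets of `X`, transported from the Fell
topology on `F(X)` by complementation `U ↦ X \ U`. -/
def opensFellTopology (X : Type*) [TopologicalSpace X] : TopologicalSpace (Opens X) :=
  TopologicalSpace.induced (fun U : Opens X => U.compl) (fellTopology X)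

/-- The Borel σ-algebra on `O(X)` transported from the Fell topology by complementation. -/
def opensFellBorel (X : Type*) [TopologicalSpace X] : MeasurableSpace (Opens X) :=
  @borel _ (opensFellTopology X)

/-- The family of open sets containing a given compact set is Borel in `O(X)`. -/
theorem measurableSet_setOf_isCompact_subset {X : Type*} [TopologicalSpace X] {K : Set X}
    (hK : IsCompact K) : MeasurableSet[opensFellBorel X] {U : Opens X | K ⊆ U} := by
  let _ := fellTopology X
  refine MeasurableSpace.measurableSet_generateFrom ?_
  refine isOpen_induced_iff.2 ⟨_, isOpen_generateFrom_of_mem (Or.inl ⟨K, hK, rfl⟩), ?_⟩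
  ext U
  simp [← Set.disjoint_iff_inter_eq_empty, Set.disjoint_compl_left_iff_subset]

/-- The family of open sets disjoint from a given open set is Borel in `O(X)`. -/
theorem measurableSet_setOf_disjoint_isOpen {X : Type*} [TopologicalSpace X] [SeparableSpace X]
    {L : Set X} (hL : IsOpen L) :
    MeasurableSet[opensFellBorel X] {V : Opens X | Disjoint (V : Set X) L} := by
  let _ := opensFellBorel X
  obtain ⟨D, hDc, hD⟩ := exists_countable_dense X
  have h : {V : Opens X | Disjoint (V : Set X) L} =
      ⋂ y ∈ D ∩ L, {V : Opens X | {y} ⊆ (V : Set X)}ᶜ := by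
    ext V
    simp only [Set.mem_ofPred_eq, Set.mem_iInter, Set.mem_compl_iff, Set.singleton_subset_iff]
    refine ⟨fun h y hy hyV => Set.disjoint_left.1 h hyV hy.2, fun h => ?_⟩
    by_contra hne
    obtain ⟨y, hy, hyD⟩ :=
      hD.inter_open_nonempty _ (V.isOpen.inter hL) (Set.not_disjoint_iff_nonempty_inter.1 hne)
    exact h y ⟨hyD, hy.2⟩ hy.1
  rw [h]
  exact MeasurableSet.biInter (hDc.mono Set.inter_subset_left) fun y _ =>
    (measurableSet_setOf_isCompact_subset isCompact_singleton).compl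

/-- `closure V ∩ U ⊆ W` expressed through a basis of the topology. -/
theorem closure_inter_subset_iff_of_isTopologicalBasis {X : Type*} [TopologicalSpace X]
    [T2Space X] [LocallyCompactSpace X] {B : Set (Set X)} (hB : IsTopologicalBasis B)
    {U W : Set X} (hU : IsOpen U) (hW : IsOpen W) (V : Set X) :
    closure V ∩ U ⊆ W ↔ ∀ b ∈ {b ∈ B | IsCompact (closure b)}, closure b ⊆ U →
      ∃ T ∈ {T : Set (Set X) | T.Finite ∧ T ⊆ B}, closure b \ ⋃₀ T ⊆ W ∧ Disjoint V (⋃₀ T) := by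
  constructor
  · rintro h b ⟨-, hbK⟩ hbU
    have hcover : closure b \ W ⊆ ⋃ i ∈ {c ∈ B | c ⊆ (closure V)ᶜ}, i := by
      intro x hx
      obtain ⟨c, hcB, hxc, hcV⟩ := hB.exists_subset_of_mem_open
        (show x ∈ (closure V)ᶜ from fun hxV => hx.2 (h ⟨hxV, hbU hx.1⟩))
        isClosed_closure.isOpen_compl
      exact Set.mem_biUnion (show c ∈ {c ∈ B | c ⊆ (closure V)ᶜ} from ⟨hcB, hcV⟩) hxc
    obtain ⟨T, hTs, hTf, hT⟩ := (hbK.diff hW).elim_finite_subcover_image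
      (fun i hi => hB.isOpen hi.1) hcover
    rw [← Set.sUnion_eq_biUnion] at hT
    refine ⟨T, ⟨hTf, fun c hc => (hTs hc).1⟩, ?_, ?_⟩
    · rintro x ⟨hxb, hxT⟩
      by_contra hxW
      exact hxT (hT ⟨hxb, hxW⟩)
    · rw [Set.disjoint_sUnion_right]
      exact fun c hc => Set.disjoint_left.2 fun x hxV hxc => (hTs hc).2 hxc (subset_closure hxV)
  · rintro h x ⟨hxV, hxU⟩
    obtain ⟨K, hK, hxK, hKU⟩ := exists_compact_subset hU hxU
    obtain ⟨b, hbB, hxb, hbK⟩ := hB.exists_subset_of_mem_open hxK isOpen_interior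
    have hcl : closure b ⊆ K := closure_minimal (hbK.trans interior_subset) hK.isClosed
    obtain ⟨T, ⟨-, hTB⟩, hTW, hTV⟩ :=
      h b ⟨hbB, hK.of_isClosed_subset isClosed_closure hcl⟩ (hcl.trans hKU)
    refine hTW ⟨subset_closure hxb, fun hxT => ?_⟩
    exact Set.disjoint_left.1
      (hTV.closure_left (isOpen_sUnion fun c hc => hB.isOpen (hTB hc))) hxV hxT

/-- For `X` a locally compact Polish space, the relation
"`closure V ∩ U ⊆ W`" is Borel on `O(X)³`: the set
`{(U, V, W) : closure V ∩ U ⊆ W}` is Borel in `O(X) × O(X) × O(X)`. -/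
theorem measurableSet_closure_inter_subset
    {X : Type*} [TopologicalSpace X] [PolishSpace X] [LocallyCompactSpace X] :
    MeasurableSet[(opensFellBorel X).prod ((opensFellBorel X).prod (opensFellBorel X))]
      {p : Opens X × Opens X × Opens X |
        closure (p.2.1 : Set X) ∩ (p.1 : Set X) ⊆ (p.2.2 : Set X)} := by
  let _ := opensFellBorel X
  have hBc := countable_countableBasis X
  have hB := isBasis_countableBasis X
  have h : {p : Opens X × Opens X × Opens X |
        closure (p.2.1 : Set X) ∩ (p.1 : Set X) ⊆ (p.2.2 : Set X)} =
      ⋂ b ∈ {b ∈ countableBasis X | IsCompact (closure b)},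
        ({p | closure b ⊆ (p.1 : Set X)}ᶜ ∪
          ⋃ T ∈ {T : Set (Set X) | T.Finite ∧ T ⊆ countableBasis X},
            {p | closure b \ ⋃₀ T ⊆ (p.2.2 : Set X)} ∩ {p | Disjoint (p.2.1 : Set X) (⋃₀ T)}) := by
    ext p
    rw [Set.mem_ofPred_eq,
      closure_inter_subset_iff_of_isTopologicalBasis hB p.1.isOpen p.2.2.isOpen (p.2.1 : Set X)]
    simp only [Set.mem_iInter, Set.mem_union, Set.mem_compl_iff, Set.mem_iUnion, Set.mem_inter_iff,
      Set.mem_ofPred_eq, imp_iff_not_or, exists_prop]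
  rw [h]
  refine MeasurableSet.biInter (hBc.mono (Set.sep_subset _ _)) fun b hb => ?_
  refine (measurable_fst (measurableSet_setOf_isCompact_subset hb.2)).compl.union ?_
  refine MeasurableSet.biUnion (Set.countable_ofPred_finite_subset hBc) fun T hT => ?_
  have hTo : IsOpen (⋃₀ T) := isOpen_sUnion fun c hc => hB.isOpen (hT.2 hc)
  exact ((measurable_snd.comp measurable_snd)
    (measurableSet_setOf_isCompact_subset (hb.2.diff hTo))).inter
    ((measurable_fst.comp measurable_snd) (measurableSet_setOf_disjoint_isOpen hTo))
end

section
/- Let X and Y be standard Borel spaces and let E and F be essentially countable Borel equivalence relations on X and Y, respectively. Suppose f : X → Y is a weak Borel reduction from E to F. If F is Borel reducible to E₀, then E is also Borel reducible to E₀ (i.e., if F is essentially hyperfinite, then so is E). -/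
universe u v

/-- A countable Borel equivalence relation on a standard Borel space: a standard Borel
space together with an equivalence relation that is Borel as a subset of the square and
all of whose classes are countable. -/
structure CountableBorelER : Type (u + 1) where
  carrier : Type u
  inst : MeasurableSpace carrier
  standardBorel : @StandardBorelSpace carrier inst
  rel : carrier → carrier → Prop
  isEquivalence : Equivalence rel
  measurableSet_rel : @MeasurableSet (carrier × carrier) (inst.prod inst) {p | rel p.1 p.2}
  countable_classes : ∀ z, {w | rel z w}.Countable

attribute [instance] CountableBorelER.inst

/-- `E` is Borel reducible to `F`: there is a Borel measurable `f` with
`E x x' ↔ F (f x) (f x')`. -/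
def BorelReducible {X Y : Type*} [MeasurableSpace X] [MeasurableSpace Y]
    (E : X → X → Prop) (F : Y → Y → Prop) : Prop :=
  ∃ f : X → Y, Measurable f ∧ ∀ a b : X, E a b ↔ F (f a) (f b)

/-- `E` is essentially countable: it is Borel bireducible with a countable Borel
equivalence relation on a standard Borel space. -/
def EssentiallyCountable {X : Type*} [MeasurableSpace X] (E : X → X → Prop) : Prop :=
  ∃ C : CountableBorelER.{u}, BorelReducible E C.rel ∧ BorelReducible C.rel E

/-- `f` is a weak Borel reduction from `E` to `F`: a Borel homomorphism such that the
preimage of each `F`-class meets only countably many `E`-classes. -/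
def WeakBorelReduction {X Y : Type*} [MeasurableSpace X] [MeasurableSpace Y]
    (E : X → X → Prop) (F : Y → Y → Prop) (f : X → Y) : Prop :=
  Measurable f ∧ (∀ a b : X, E a b → F (f a) (f b)) ∧
    ∀ y : Y, ∃ S : Set X, S.Countable ∧ ∀ x : X, F (f x) y → ∃ x' ∈ S, E x x'

/-- The equivalence relation `E₀` of eventual equality on `{0,1}^ℕ`. -/
def E₀ : (ℕ → Bool) → (ℕ → Bool) → Prop :=
  fun x y => ∃ m : ℕ, ∀ n : ℕ, m ≤ n → x n = y n

open Set Topology MeasureTheory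

theorem MeasureTheory.AnalyticSet.inter {X : Type*} [TopologicalSpace X] [T2Space X] {s t : Set X}
    (hs : AnalyticSet s) (ht : AnalyticSet t) : AnalyticSet (s ∩ t) := by
  rw [inter_eq_iInter]
  exact .iInter (by rintro (_ | _) <;> assumption)

/-- An analytic set on which a continuous map is injective is contained in a Borel set on which
the map is still injective. -/
theorem MeasureTheory.AnalyticSet.exists_measurableSet_superset_injOn {X Z : Type*}
    [TopologicalSpace X] [PolishSpace X] [MeasurableSpace X] [BorelSpace X]
    [TopologicalSpace Z] [T2Space Z] [MeasurableSpace Z] [BorelSpace Z]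
    {k : X → Z} (hk : Continuous k) {A : Set X} (hA : AnalyticSet A) (hinj : InjOn k A) :
    ∃ B, MeasurableSet B ∧ A ⊆ B ∧ InjOn k B := by
  have hsep (V : TopologicalSpace.countableBasis X) :
      MeasurablySeparable (k '' (A ∩ V)) (k '' (A ∩ (V : Set X)ᶜ)) := by
    have hV : IsOpen (V : Set X) := TopologicalSpace.isOpen_of_mem_countableBasis V.2
    refine AnalyticSet.measurablySeparable
      ((hA.inter hV.measurableSet.analyticSet).image_of_continuous hk)
      ((hA.inter hV.measurableSet.compl.analyticSet).image_of_continuous hk) ?_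
    rw [Set.disjoint_left]
    rintro _ ⟨x, ⟨hxA, hxV⟩, rfl⟩ ⟨y, ⟨hyA, hyV⟩, hxy⟩
    exact hyV (hinj hyA hxA hxy ▸ hxV)
  choose D hD hD' hDm using hsep
  refine ⟨⋂ V : TopologicalSpace.countableBasis X, {x | x ∈ (V : Set X) ↔ k x ∈ D V}, ?_, ?_, ?_⟩
  · refine MeasurableSet.iInter fun V ↦ ?_
    exact (TopologicalSpace.isOpen_of_mem_countableBasis V.2).measurableSet.iff
      (hk.measurable (hDm V))
  · refine fun x hx ↦ mem_iInter.2 fun V ↦ ⟨fun hV ↦ hD V ⟨x, ⟨hx, hV⟩, rfl⟩, fun hV ↦ ?_⟩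
    by_contra h
    exact Set.disjoint_left.1 (hD' V) ⟨x, ⟨hx, h⟩, rfl⟩ hV
  · intro x hx y hy hxy
    by_contra hne
    obtain ⟨V, hV, hxV, hVy⟩ := (TopologicalSpace.isBasis_countableBasis X).exists_subset_of_mem_open
      (show x ∈ ({y} : Set X)ᶜ from hne) isOpen_compl_singleton
    have hx' := (mem_iInter.1 hx ⟨V, hV⟩).1 hxV
    rw [hxy] at hx'
    exact hVy ((mem_iInter.1 hy ⟨V, hV⟩).2 hx') rfl

/-- A set covered by countably many Borel sets on each of which `k` is injective. -/
def IsSigmaInjOn {X Z : Type*} [MeasurableSpace X] (k : X → Z) (A : Set X) : Prop :=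
  ∃ B : ℕ → Set X, (∀ n, MeasurableSet (B n) ∧ InjOn k (B n)) ∧ A ⊆ ⋃ n, B n

theorem IsSigmaInjOn.of_injOn {X Z : Type*} [MeasurableSpace X] {k : X → Z} {B : Set X}
    (hB : MeasurableSet B) (h : InjOn k B) : IsSigmaInjOn k B :=
  ⟨fun _ ↦ B, fun _ ↦ ⟨hB, h⟩, subset_iUnion (fun _ : ℕ ↦ B) 0⟩

theorem IsSigmaInjOn.iUnion {X Z ι : Type*} [Countable ι] [MeasurableSpace X] {k : X → Z}
    {A : ι → Set X} (h : ∀ i, IsSigmaInjOn k (A i)) : IsSigmaInjOn k (⋃ i, A i) := by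
  choose B hB hAB using h
  rcases isEmpty_or_nonempty ι with hι | hι
  · exact ⟨fun _ ↦ ∅, fun _ ↦ ⟨.empty, injOn_empty k⟩, by simp⟩
  obtain ⟨e, he⟩ := exists_surjective_nat (ι × ℕ)
  refine ⟨fun n ↦ B (e n).1 (e n).2, fun n ↦ hB _ _, iUnion_subset fun i x hx ↦ ?_⟩
  obtain ⟨m, hm⟩ := mem_iUnion.1 (hAB i hx)
  obtain ⟨n, hn⟩ := he (i, m)
  exact mem_iUnion.2 ⟨n, by simpa [hn] using hm⟩

/-- If `k` is continuous on a Polish space, then after discarding a set covered by countably many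
Borel sets on which `k` is injective, every finite family of basic open sets meeting a common fibre
of `k` meets a common fibre of which a prescribed member of the family contains two points. -/
theorem exists_isSigmaInjOn_compl_forall_split {X Z : Type*}
    [TopologicalSpace X] [PolishSpace X] [MeasurableSpace X] [BorelSpace X]
    [TopologicalSpace Z] [T2Space Z] [MeasurableSpace Z] [BorelSpace Z]
    {k : X → Z} (hk : Continuous k) :
    ∃ Y : Set X, IsSigmaInjOn k Yᶜ ∧
      ∀ (p : Finset (TopologicalSpace.countableBasis X)) (i) (_ : i ∈ p) (z : Z)
        (_ : ∀ V ∈ p, z ∈ k '' (Y ∩ V)),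
        ∃ a ∈ Y ∩ i, ∃ b ∈ Y ∩ i, a ≠ b ∧ k a = k b ∧ ∀ V ∈ p, k a ∈ k '' (Y ∩ V) := by
  let Bad (p : Finset (TopologicalSpace.countableBasis X)) (Y : Set X) : Prop :=
    MeasurableSet Y ∧ IsSigmaInjOn k Yᶜ ∧ ¬ ∃ z, ∀ V ∈ p, z ∈ k '' (Y ∩ V)
  have hW (p : Finset (TopologicalSpace.countableBasis X)) : ∃ W : Set X, MeasurableSet W ∧
      IsSigmaInjOn k Wᶜ ∧ ((∃ Y, Bad p Y) → Bad p W) := by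
    by_cases h : ∃ Y, Bad p Y
    · obtain ⟨Y, hY⟩ := h
      exact ⟨Y, hY.1, hY.2.1, fun _ ↦ hY⟩
    · exact ⟨univ, .univ, by simpa using IsSigmaInjOn.of_injOn .empty (injOn_empty k),
        fun h' ↦ (h h').elim⟩
  choose W hWm hWs hWb using hW
  have hYm : MeasurableSet (⋂ p, W p) := MeasurableSet.iInter hWm
  have hYs : IsSigmaInjOn k (⋂ p, W p)ᶜ := by
    rw [compl_iInter]
    exact IsSigmaInjOn.iUnion hWs
  refine ⟨⋂ p, W p, hYs, ?_⟩
  set Y := ⋂ p, W p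
  intro p i hi z hz
  by_contra! hcon
  have hmeas (V : TopologicalSpace.countableBasis X) : AnalyticSet (Y ∩ V : Set X) :=
    (hYm.inter (TopologicalSpace.isOpen_of_mem_countableBasis V.2).measurableSet).analyticSet
  have hA : AnalyticSet ((Y ∩ i) ∩ k ⁻¹' ⋂ V : p, k '' (Y ∩ V)) := by
    have : Nonempty p := ⟨⟨i, hi⟩⟩
    exact (hmeas i).inter
      (AnalyticSet.preimage (.iInter fun V : p ↦ (hmeas V).image_of_continuous hk) hk)
  obtain ⟨B, hBm, hAB, hBi⟩ := hA.exists_measurableSet_superset_injOn hk (by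
    rintro a ⟨ha, ha'⟩ b ⟨hb, -⟩ hab
    by_contra hne
    obtain ⟨V, hV, hV'⟩ := hcon a ha b hb hne hab
    exact hV' (mem_iInter.1 ha' ⟨V, hV⟩))
  have hbad : Bad p (Y \ B) := by
    refine ⟨hYm.diff hBm, ?_, ?_⟩
    · rw [sdiff_eq, compl_inter, compl_compl, union_eq_iUnion]
      refine IsSigmaInjOn.iUnion fun b ↦ ?_
      cases b
      exacts [IsSigmaInjOn.of_injOn hBm hBi, hYs]
    · rintro ⟨w, hw⟩
      obtain ⟨x, ⟨⟨hxY, hxB⟩, hxi⟩, rfl⟩ := hw i hi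
      refine hxB (hAB ⟨⟨hxY, hxi⟩, mem_iInter.2 fun V ↦ ?_⟩)
      exact image_mono (inter_subset_inter_left _ sdiff_subset) (hw V V.2)
  exact (hWb p ⟨_, hbad⟩).2.2
    ⟨z, fun V hV ↦ image_mono (inter_subset_inter_left _ (iInter_subset _ p)) (hz V hV)⟩

/-- A continuous map with countable fibres on a Polish space is injective on each piece of some
countable Borel cover. -/
theorem isSigmaInjOn_univ_of_continuous {X Z : Type*}
    [TopologicalSpace X] [PolishSpace X] [MeasurableSpace X] [BorelSpace X]
    [TopologicalSpace Z] [T2Space Z] [MeasurableSpace Z] [BorelSpace Z]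
    {k : X → Z} (hk : Continuous k) (hfib : ∀ z, (k ⁻¹' {z}).Countable) :
    IsSigmaInjOn k univ := by
  obtain ⟨Y, hYs, hY⟩ := exists_isSigmaInjOn_compl_forall_split hk
  rcases Y.eq_empty_or_nonempty with rfl | ⟨y, hy⟩
  · simpa using hYs
  exfalso
  let := TopologicalSpace.upgradeIsCompletelyMetrizable X
  let S : Set (ℕ → X) := {x | (∀ n, x n ∈ Y) ∧ ∀ n, k (x n) = k (x 0)}
  have : PolishSpace (closure S) := isClosed_closure.polishSpace
  have hcl : closure S ⊆ {x | ∀ n, k (x n) = k (x 0)} := by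
    refine closure_minimal (fun x hx ↦ hx.2) ?_
    simp only [ofPred_forall]
    exact isClosed_iInter fun n ↦ isClosed_eq (hk.comp (continuous_apply n)) (hk.comp (continuous_apply 0))
  let O (q : ℕ × ℕ) : Set (ℕ → X) :=
    {x | ∃ j, x j ≠ x q.1 ∧ dist (x j) (x q.1) < 1 / ((q.2 : ℝ) + 1)}
  have hOo (q) : IsOpen (O q) := by
    simp only [O, ofPred_exists]
    refine isOpen_iUnion fun j ↦ IsOpen.inter ?_ ?_
    · exact isOpen_ne_fun (continuous_apply j) (continuous_apply q.1)
    · exact isOpen_lt ((continuous_apply j).dist (continuous_apply q.1)) continuous_const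
  have hOd (q) : closure S ⊆ closure (S ∩ O q) := by
    refine closure_minimal (fun x hx ↦ ?_) isClosed_closure
    rw [mem_closure_iff]
    intro G hG hxG
    obtain ⟨I, u, hu, huG⟩ := isOpen_pi_iff.1 hG x hxG
    have hc (j : ℕ) : ∃ V : TopologicalSpace.countableBasis X, x j ∈ (V : Set X) ∧
        (j ∈ I → (V : Set X) ⊆ u j) ∧ (V : Set X) ⊆ Metric.ball (x j) (1 / ((q.2 : ℝ) + 1) / 2) := by
      have hpos : 0 < 1 / ((q.2 : ℝ) + 1) / 2 := by positivity
      by_cases hj : j ∈ I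
      · obtain ⟨V, hV, hxV, hVu⟩ :=
          (TopologicalSpace.isBasis_countableBasis X).exists_subset_of_mem_open
          (show x j ∈ u j ∩ Metric.ball (x j) (1 / ((q.2 : ℝ) + 1) / 2) from
            ⟨(hu j hj).2, Metric.mem_ball_self hpos⟩) ((hu j hj).1.inter Metric.isOpen_ball)
        exact ⟨⟨V, hV⟩, hxV, fun _ ↦ hVu.trans inter_subset_left, hVu.trans inter_subset_right⟩
      · obtain ⟨V, hV, hxV, hVu⟩ :=
          (TopologicalSpace.isBasis_countableBasis X).exists_subset_of_mem_open
          (Metric.mem_ball_self hpos) (Metric.isOpen_ball (x := x j))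
        exact ⟨⟨V, hV⟩, hxV, fun h ↦ (hj h).elim, hVu⟩
    choose c hxc hcu hcb using hc
    classical
    obtain ⟨a, ha, b, hb, hab, hkab, hp⟩ := hY ((insert q.1 I).image c) (c q.1) (by simp) (k (x 0))
      (by
        simp only [Finset.mem_image]
        rintro _ ⟨j, -, rfl⟩
        exact ⟨x j, ⟨hx.1 j, hxc j⟩, hx.2 j⟩)
    have hw (j : ℕ) : ∃ w ∈ Y, k w = k a ∧ (j ∈ I → w ∈ (c j : Set X)) := by
      by_cases hj : j ∈ I
      · obtain ⟨w, hw, hwa⟩ := hp (c j) (Finset.mem_image_of_mem c (Finset.mem_insert_of_mem hj))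
        exact ⟨w, hw.1, hwa, fun _ ↦ hw.2⟩
      · exact ⟨a, ha.1, rfl, fun h ↦ (hj h).elim⟩
    choose w hwY hwk hwc using hw
    obtain ⟨m, hm⟩ := Infinite.exists_notMem_finset (insert q.1 I)
    have hmq : q.1 ≠ m := fun h ↦ hm (h ▸ Finset.mem_insert_self _ _)
    have hmI : m ∉ I := fun h ↦ hm (Finset.mem_insert_of_mem h)
    let v := Function.update (Function.update w q.1 a) m b
    have hvq : v q.1 = a := by simp [v, Function.update_of_ne hmq]
    have hvm : v m = b := by simp [v]
    have hvj (j) (h1 : j ≠ q.1) (h2 : j ≠ m) : v j = w j := by simp [v, h1, h2]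
    have hv (j) : v j ∈ Y ∧ k (v j) = k a ∧ (j ∈ I → v j ∈ u j) := by
      rcases eq_or_ne j m with rfl | h2
      · rw [hvm]
        exact ⟨hb.1, hkab.symm, fun h ↦ (hmI h).elim⟩
      rcases eq_or_ne j q.1 with rfl | h1
      · rw [hvq]
        exact ⟨ha.1, rfl, fun h ↦ hcu _ h ha.2⟩
      rw [hvj j h1 h2]
      exact ⟨hwY j, hwk j, fun h ↦ hcu _ h (hwc j h)⟩
    refine ⟨v, huG fun j hj ↦ (hv j).2.2 hj, ⟨fun j ↦ (hv j).1, fun j ↦ ?_⟩, m, ?_, ?_⟩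
    · rw [(hv j).2.1, (hv 0).2.1]
    · rw [hvm, hvq]
      exact hab.symm
    · rw [hvm, hvq]
      have h1 := Metric.mem_ball.1 (hcb _ ha.2)
      have h2 := Metric.mem_ball.1 (hcb _ hb.2)
      linarith [dist_triangle_right b a (x q.1)]
  have hdense : Dense (⋂ q, ((↑) : closure S → ℕ → X) ⁻¹' O q) := by
    refine dense_iInter_of_isOpen (fun q ↦ (hOo q).preimage continuous_subtype_val) fun q ↦ ?_
    rw [Subtype.dense_iff]
    refine (hOd q).trans (closure_mono fun x hx ↦ ?_)
    exact ⟨⟨x, subset_closure hx.1⟩, hx.2, rfl⟩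
  have : Nonempty (closure S) := ⟨⟨fun _ ↦ y, subset_closure ⟨fun _ ↦ hy, fun _ ↦ rfl⟩⟩⟩
  obtain ⟨⟨x, hxS⟩, hx⟩ := hdense.nonempty
  have hxO (q) : x ∈ O q := mem_iInter.1 hx q
  have hperf : Preperfect (range x) := by
    rintro _ ⟨i, rfl⟩
    rw [accPt_iff_nhds]
    intro U hU
    obtain ⟨ε, hε, hεU⟩ := Metric.mem_nhds_iff.1 hU
    obtain ⟨n, hn⟩ := exists_nat_one_div_lt hε
    obtain ⟨j, hj, hj'⟩ := hxO (i, n)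
    exact ⟨x j, ⟨hεU (hj'.trans hn), j, rfl⟩, hj⟩
  obtain ⟨g, hg, -, hgi⟩ := hperf.perfect_closure.exists_nat_bool_injection
    ((range_nonempty x).mono subset_closure)
  have hsub : closure (range x) ⊆ k ⁻¹' {k (x 0)} := by
    refine closure_minimal ?_ (isClosed_singleton.preimage hk)
    rintro _ ⟨n, rfl⟩
    exact hcl hxS n
  have hcount : Countable (ℕ → Bool) := by
    have := ((hfib (k (x 0))).mono (hg.trans hsub)).to_subtype
    exact (rangeFactorization_injective.2 hgi).countable
  obtain ⟨e, he⟩ := exists_surjective_nat (ℕ → Bool)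
  obtain ⟨n, hn⟩ := he fun n ↦ !e n n
  simpa using congrFun hn n

/-- A countable-to-one Borel map can be made injective by adjoining a Borel map into `ℕ`. -/
theorem exists_measurable_nat_injective_prodMk {X Z : Type*} [MeasurableSpace X]
    [StandardBorelSpace X] [TopologicalSpace Z] [T2Space Z] [SecondCountableTopology Z]
    [MeasurableSpace Z] [BorelSpace Z]
    {k : X → Z} (hk : Measurable k) (hfib : ∀ z, (k ⁻¹' {z}).Countable) :
    ∃ l : X → ℕ, Measurable l ∧ Function.Injective fun x ↦ (k x, l x) := by
  obtain ⟨B, hB, hcov⟩ : IsSigmaInjOn k univ := by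
    obtain ⟨t, ht, htp⟩ := StandardBorelSpace.polish (α := X)
    obtain ⟨t', ht', hkc, hp⟩ := hk.exists_continuous
    have hborel : @BorelSpace X t' _ := by
      constructor
      rw [ht.measurable_eq]
      exact (borel_eq_borel_of_le hp htp ht').symm
    exact @isSigmaInjOn_univ_of_continuous X Z t' hp _ hborel _ _ _ _ k hkc hfib
  have hex (x : X) : ∃ n, x ∈ B n := mem_iUnion.1 (hcov (mem_univ x))
  classical
  refine ⟨fun x ↦ Nat.find (hex x), measurable_find hex fun n ↦ (hB n).1, fun x y hxy ↦ ?_⟩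
  obtain ⟨h1, h2⟩ := Prod.mk.inj hxy
  refine (hB _).2 (Nat.find_spec (hex x)) ?_ h1
  rw [show Nat.find (hex x) = Nat.find (hex y) from h2]
  exact Nat.find_spec (hex y)

/-- Equality up to finitely many coordinates of sequences indexed by a countable type reduces
to `E₀`. -/
theorem borelReducible_E₀_of_finite_ne {X J : Type*} [MeasurableSpace X] [Countable J]
    {R : X → X → Prop} (β : J → X → Bool) (hβ : ∀ j, Measurable (β j))
    (h : ∀ a b, R a b ↔ {j | β j a ≠ β j b}.Finite) : BorelReducible R E₀ := by
  have := Encodable.ofCountable J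
  refine ⟨fun a i ↦ (Encodable.decode₂ J i).elim false fun j ↦ β j a, ?_, fun a b ↦ ?_⟩
  · refine measurable_pi_lambda _ fun i ↦ ?_
    cases Encodable.decode₂ J i
    exacts [measurable_const, hβ _]
  · rw [h]
    constructor
    · intro hfin
      obtain ⟨m, hm⟩ := (hfin.image Encodable.encode).bddAbove
      refine ⟨m + 1, fun n hn ↦ ?_⟩
      cases hd : Encodable.decode₂ J n with
      | none => simp [hd]
      | some j =>
        simp only [hd, Option.elim_some]
        by_contra hne
        have := hm ⟨j, hne, rfl⟩
        rw [Encodable.mem_decode₂.1 hd] at this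
        omega
    · rintro ⟨m, hm⟩
      refine ((finite_Iio m).preimage Encodable.encode_injective.injOn).subset fun j hj ↦ ?_
      by_contra hlt
      have := hm _ (not_lt.1 hlt)
      simp only [Encodable.encodek₂, Option.elim_some] at this
      exact hj this

/-- Replace the first `n` terms of the sequence `u` by `s`. -/
def replaceInit (n : ℕ) (s : Fin n → Bool) (u : ℕ → Bool) : ℕ → Bool :=
  fun i ↦ if h : i < n then s ⟨i, h⟩ else u i

theorem measurable_replaceInit (n : ℕ) (s : Fin n → Bool) : Measurable (replaceInit n s) := by
  refine measurable_pi_lambda _ fun i ↦ ?_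
  by_cases h : i < n <;> simp only [replaceInit, h, dite_true, dite_false] <;> fun_prop

theorem replaceInit_congr {n : ℕ} (s : Fin n → Bool) {u v : ℕ → Bool}
    (h : ∀ i, n ≤ i → u i = v i) : replaceInit n s u = replaceInit n s v := by
  funext i
  by_cases hi : i < n <;> simp only [replaceInit, hi, dite_true, dite_false]
  exact h i (not_lt.1 hi)

theorem replaceInit_self {n : ℕ} {u v : ℕ → Bool} (h : ∀ i, n ≤ i → u i = v i) :
    replaceInit n (fun i ↦ u i) v = u := by
  funext i
  by_cases hi : i < n <;> simp only [replaceInit, hi, dite_true, dite_false]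
  exact (h i (not_lt.1 hi)).symm

/-- A Borel equivalence relation with a countable-to-one Borel homomorphism to `E₀` is reducible
to `E₀`. -/
theorem borelReducible_E₀_of_countable_to_one {X : Type*} [MeasurableSpace X]
    [StandardBorelSpace X] {R : X → X → Prop} (hR : Equivalence R)
    (hRm : MeasurableSet {p : X × X | R p.1 p.2}) {k : X → ℕ → Bool} (hk : Measurable k)
    (hhom : ∀ a b, R a b → E₀ (k a) (k b)) (hfib : ∀ z, (k ⁻¹' {z}).Countable) :
    BorelReducible R E₀ := by
  obtain ⟨l, hl, hinj⟩ := exists_measurable_nat_injective_prodMk hk hfib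
  let D (n : ℕ) (t : (Fin n → Bool) × Fin n) : Set X :=
    {a | ∃ c, R a c ∧ k c = replaceInit n t.1 (k a) ∧ l c = t.2}
  have hD (n t) : MeasurableSet (D n t) := by
    have hset : MeasurableSet {p : X × X | R p.1 p.2 ∧ k p.2 = replaceInit n t.1 (k p.1) ∧
        l p.2 = t.2} := by
      refine hRm.inter (.inter ?_ ?_)
      · exact measurableSet_eq_fun (hk.comp measurable_snd)
          ((measurable_replaceInit n t.1).comp (hk.comp measurable_fst))
      · exact measurableSet_eq_fun (hl.comp measurable_snd) measurable_const
    convert hset.image_of_measurable_injOn measurable_fst ?_ using 1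
    · ext a
      simp [D]
    · rintro ⟨a, c⟩ ⟨-, h1, h2⟩ ⟨a', c'⟩ ⟨-, h1', h2'⟩ rfl
      have : c = c' := hinj (Prod.ext (h1.trans h1'.symm) (h2.trans h2'.symm))
      rw [this]
  classical
  refine borelReducible_E₀_of_finite_ne (J := (Σ n, (Fin n → Bool) × Fin n) ⊕ ℕ)
    (Sum.elim (fun t a ↦ decide (a ∈ D t.1 t.2)) fun n a ↦ k a n) ?_ fun a b ↦ ⟨fun hab ↦ ?_, ?_⟩
  · rintro (t | n)
    · exact measurable_to_bool (by simpa [preimage] using hD t.1 t.2)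
    · exact (measurable_pi_apply n).comp hk
  · obtain ⟨m, hm⟩ := hhom a b hab
    have hfin : {t : Σ n, (Fin n → Bool) × Fin n | t.1 < m}.Finite :=
      ((Finset.range m).sigma fun _ ↦ Finset.univ).finite_toSet.subset fun t ht ↦ by simpa using ht
    refine ((hfin.image Sum.inl).union ((finite_Iio m).image Sum.inr)).subset ?_
    rintro (t | n) hne
    · refine .inl ⟨t, ?_, rfl⟩
      by_contra hlt
      refine hne (decide_eq_decide.2 (exists_congr fun c ↦ ?_))
      rw [replaceInit_congr t.2.1 fun i hi ↦ hm i ((not_lt.1 hlt).trans hi)]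
      exact and_congr_left' ⟨hR.trans (hR.symm hab), hR.trans hab⟩
    · refine .inr ⟨n, ?_, rfl⟩
      by_contra hlt
      exact hne (hm n (not_lt.1 hlt))
  · intro hfin
    obtain ⟨M, hM⟩ := (hfin.image (Sum.elim Sigma.fst id)).bddAbove
    let n := max (M + 1) (l a + 1)
    have hk' (i : ℕ) (hi : n ≤ i) : k a i = k b i := by
      by_contra hne
      have : i ≤ M := hM ⟨.inr i, hne, rfl⟩
      omega
    let t : (Fin n → Bool) × Fin n := (fun i ↦ k a i, ⟨l a, by omega⟩)
    have hD' : a ∈ D n t ↔ b ∈ D n t := by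
      by_contra hne
      have : n ≤ M := hM ⟨.inl ⟨n, t⟩, fun h ↦ hne (decide_eq_decide.1 h), rfl⟩
      omega
    obtain ⟨c, hbc, hkc, hlc⟩ :=
      hD'.1 ⟨a, hR.refl a, (replaceInit_self fun _ _ ↦ rfl).symm, rfl⟩
    have hca : c = a := hinj (Prod.ext (hkc.trans (replaceInit_self hk')) hlc)
    exact hR.symm (hca ▸ hbc)

/-- Let `E` and `F` be essentially countable Borel equivalence relations
on standard Borel spaces `X` and `Y`, and let `f : X → Y` be a weak Borel reduction from
`E` to `F`.  If `F` is Borel reducible to `E₀`, then so is `E` (i.e., if `F` is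
essentially hyperfinite then so is `E`). -/
theorem essentially_hyperfinite_of_weak_reduction
    {X Y : Type*} [MeasurableSpace X] [StandardBorelSpace X]
    [MeasurableSpace Y] [StandardBorelSpace Y]
    (E : X → X → Prop) (F : Y → Y → Prop)
    (hEeq : Equivalence E) (hFeq : Equivalence F)
    (hEmeas : MeasurableSet {p : X × X | E p.1 p.2})
    (hFmeas : MeasurableSet {p : Y × Y | F p.1 p.2})
    (hEec : EssentiallyCountable.{u} E) (hFec : EssentiallyCountable.{v} F)
    (f : X → Y) (hf : WeakBorelReduction E F f)
    (hF : BorelReducible F E₀) :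
    BorelReducible E E₀ := by
  obtain ⟨C, ⟨g, hg, hgE⟩, ⟨h, hh, hhE⟩⟩ := hEec
  obtain ⟨r, hr, hrF⟩ := hF
  obtain ⟨hfm, hfhom, hfc⟩ := hf
  have := C.standardBorel
  suffices BorelReducible C.rel E₀ by
    obtain ⟨q, hq, hqE⟩ := this
    exact ⟨q ∘ g, hq.comp hg, fun a b ↦ (hgE a b).trans (hqE _ _)⟩
  refine borelReducible_E₀_of_countable_to_one C.isEquivalence C.measurableSet_rel
    (k := r ∘ f ∘ h) (hr.comp (hfm.comp hh))
    (fun a b hab ↦ (hrF _ _).1 (hfhom _ _ ((hhE a b).1 hab))) fun z ↦ ?_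
  rcases (r ∘ f ∘ h ⁻¹' {z}).eq_empty_or_nonempty with hz | ⟨c₀, hc₀⟩
  · exact hz ▸ countable_empty
  obtain ⟨S, hS, hcov⟩ := hfc (f (h c₀))
  have hclass (x : X) : {c | E (h c) x}.Countable := by
    rcases {c | E (h c) x}.eq_empty_or_nonempty with hx | ⟨c₁, hc₁⟩
    · exact hx ▸ countable_empty
    · exact (C.countable_classes c₁).mono fun c hc ↦
        (hhE c₁ c).2 (hEeq.trans hc₁ (hEeq.symm hc))
  refine (hS.biUnion fun x _ ↦ hclass x).mono fun c hc ↦ ?_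
  have hcc₀ : r (f (h c)) = r (f (h c₀)) := hc.trans hc₀.symm
  obtain ⟨x, hx, hE⟩ := hcov (h c) ((hrF _ _).2 ⟨0, fun n _ ↦ by rw [hcc₀]⟩)
  exact mem_biUnion hx hE
end
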